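/- Let h : ℝ^{d×N} → [0,∞) be quasiconvex and satisfy h(z) ≤ c(1+|z|) for some c > 0. Then its recession function h^∞(z) := limsup_{t→∞} h(tz)/t is quasiconvex. -/

import Mathlib

open MeasureTheory Filter

noncomputable section

/-- The open unit cube `(0,1)^N`. -/
def unitCube (N : ℕ) : Set (Fin N → ℝ) := Set.univ.pi fun _ => Set.Ioo (0:ℝ) 1

/-- The gradient of `φ : ℝ^N → ℝ^d` as a `d × N` matrix. -/
def gradMatrix {N d : ℕ} (φ : (Fin N → ℝ) → (Fin d → ℝ)) (x : Fin N → ℝ) :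
    Fin d → Fin N → ℝ := fun i j => fderiv ℝ φ x (Pi.single j 1) i

/-- `h` is quasiconvex if `h(z) ≤ ∫_Q h(z + ∇φ)` for all Lipschitz `φ` vanishing on `∂Q`. -/
def IsQuasiconvexFn {d N : ℕ} (h : (Fin d → Fin N → ℝ) → ℝ) : Prop :=
  ∀ (z : Fin d → Fin N → ℝ) (φ : (Fin N → ℝ) → (Fin d → ℝ)),
    (∃ K : NNReal, LipschitzWith K φ) → (∀ x ∈ frontier (unitCube N), φ x = 0) →
      h z ≤ ∫ x in unitCube N, h (z + gradMatrix φ x)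

/-- The recession function `h^∞(z) := limsup_{t→∞} h(tz)/t`. -/
def recessionOf {d N : ℕ} (h : (Fin d → Fin N → ℝ) → ℝ) (z : Fin d → Fin N → ℝ) : ℝ :=
  Filter.limsup (fun t : ℝ => h (t • z) / t) Filter.atTop

lemma isOpen_unitCube (N : ℕ) : IsOpen (unitCube N) :=
  isOpen_set_pi Set.finite_univ fun _ _ => isOpen_Ioo

lemma volume_unitCube (N : ℕ) : volume (unitCube N) = 1 := by
  simp [unitCube, volume_pi_pi]

lemma norm_gradMatrix_le {N d : ℕ} {φ : (Fin N → ℝ) → (Fin d → ℝ)} {K : NNReal}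
    (hφ : LipschitzWith K φ) (x : Fin N → ℝ) : ‖gradMatrix φ x‖ ≤ K := by
  refine (pi_norm_le_iff_of_nonneg K.2).2 fun i => (pi_norm_le_iff_of_nonneg K.2).2 fun j => ?_
  calc ‖gradMatrix φ x i j‖ ≤ ‖fderiv ℝ φ x (Pi.single j 1)‖ :=
        norm_le_pi_norm (fderiv ℝ φ x (Pi.single j 1)) i
    _ ≤ ‖fderiv ℝ φ x‖ * ‖(Pi.single j 1 : Fin N → ℝ)‖ := ContinuousLinearMap.le_opNorm _ _
    _ ≤ K * 1 := by
        gcongr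
        · exact norm_fderiv_le_of_lipschitz ℝ hφ
        · simp [Pi.norm_single]
    _ = K := mul_one _

lemma measurable_gradMatrix {N d : ℕ} (φ : (Fin N → ℝ) → (Fin d → ℝ)) :
    Measurable (gradMatrix φ) :=
  measurable_pi_lambda _ fun i => measurable_pi_lambda _ fun j =>
    (measurable_pi_apply i).comp (measurable_fderiv_apply_const ℝ φ (Pi.single j 1))

lemma gradMatrix_const_smul {N d : ℕ} (φ : (Fin N → ℝ) → (Fin d → ℝ)) (t : ℝ)
    (x : Fin N → ℝ) : gradMatrix (t • φ) x = t • gradMatrix φ x := by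
  ext i j
  simp [gradMatrix, fderiv_const_smul_field]

/-- The linear map `x ↦ B x`, truncated near the boundary of the unit cube so that it vanishes
there. -/
def truncatedLinear {N d : ℕ} (B : Fin d → Fin N → ℝ) (M : NNReal) (x : Fin N → ℝ) :
    Fin d → ℝ := fun i =>
  max (-(M * Metric.infDist x (unitCube N)ᶜ)) (min (M * Metric.infDist x (unitCube N)ᶜ)
    (∑ j, B i j * x j))

lemma abs_matrix_apply_le {N d : ℕ} (B : Fin d → Fin N → ℝ) (x : Fin N → ℝ) (i : Fin d) :
    |∑ j, B i j * x j| ≤ N * ‖B‖ * ‖x‖ := by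
  calc |∑ j, B i j * x j| ≤ ∑ j, |B i j * x j| := Finset.abs_sum_le_sum_abs _ _
    _ ≤ ∑ _j : Fin N, ‖B‖ * ‖x‖ := by
        gcongr with j
        rw [abs_mul]
        gcongr
        · exact (norm_le_pi_norm (B i) j).trans (norm_le_pi_norm B i)
        · exact norm_le_pi_norm x j
    _ = N * ‖B‖ * ‖x‖ := by simp [mul_assoc]

lemma lipschitzWith_truncatedLinear {N d : ℕ} (B : Fin d → Fin N → ℝ) {M : NNReal}
    (hM : N * ‖B‖ ≤ M) : LipschitzWith M (truncatedLinear B M) := by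
  have hδ : LipschitzWith M fun x => (M : ℝ) * Metric.infDist x (unitCube N)ᶜ := by
    refine LipschitzWith.of_dist_le_mul fun x y => ?_
    rw [Real.dist_eq, ← mul_sub, abs_mul, NNReal.abs_eq]
    gcongr
    simpa [Real.dist_eq] using (Metric.lipschitz_infDist_pt (unitCube N)ᶜ).dist_le_mul x y
  refine LipschitzWith.of_dist_le_mul fun x y =>
    (dist_pi_le_iff (by positivity)).2 fun i => ?_
  have hB : LipschitzWith M fun x : Fin N → ℝ => ∑ j, B i j * x j := by
    refine LipschitzWith.of_dist_le_mul fun x y => ?_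
    rw [Real.dist_eq, ← Finset.sum_sub_distrib, dist_eq_norm]
    simp_rw [← mul_sub]
    exact (abs_matrix_apply_le B (x - y) i).trans (by gcongr)
  have := hδ.neg.max (hδ.min hB)
  simp only [max_self] at this
  exact this.dist_le_mul x y

lemma truncatedLinear_eq_zero {N d : ℕ} (B : Fin d → Fin N → ℝ) (M : NNReal)
    {x : Fin N → ℝ} (hx : x ∈ frontier (unitCube N)) : truncatedLinear B M x = 0 := by
  have hx' : x ∈ (unitCube N)ᶜ := by
    rw [(isOpen_unitCube N).frontier_eq] at hx
    exact hx.2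
  ext i
  simp [truncatedLinear, Metric.infDist_zero_of_mem hx']

/-- The unit cube shrunk by `r` from every face. -/
def shrunkCube (N : ℕ) (r : ℝ) : Set (Fin N → ℝ) := Set.univ.pi fun _ => Set.Ioo r (1 - r)

lemma le_infDist_of_mem_shrunkCube {N : ℕ} [NeZero N] {r : ℝ} {x : Fin N → ℝ}
    (hx : x ∈ shrunkCube N r) : r ≤ Metric.infDist x (unitCube N)ᶜ := by
  have hne : (unitCube N)ᶜ.Nonempty := ⟨0, fun h => lt_irrefl _ (h 0 trivial).1⟩
  refine (Metric.le_infDist hne).2 fun y hy => ?_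
  by_contra! hlt
  refine hy fun k _ => ?_
  have h1 := (dist_le_pi_dist x y k).trans_lt hlt
  rw [Real.dist_eq, abs_lt] at h1
  have h2 := hx k trivial
  simp only [Set.mem_Ioo] at h2
  exact ⟨by linarith, by linarith⟩

lemma gradMatrix_truncatedLinear {N d : ℕ} [NeZero N] (B : Fin d → Fin N → ℝ) {M : NNReal}
    {r : ℝ} (hr : 0 < r) (hM : N * ‖B‖ ≤ M * r) {x : Fin N → ℝ} (hx : x ∈ shrunkCube N r) :
    gradMatrix (truncatedLinear B M) x = B := by
  have hopen : IsOpen (shrunkCube N r) := isOpen_set_pi Set.finite_univ fun _ _ => isOpen_Ioo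
  have heq : truncatedLinear B M =ᶠ[nhds x]
      (Matrix.mulVecLin (Matrix.of B)).toContinuousLinearMap := by
    filter_upwards [hopen.mem_nhds hx] with y hy
    ext i
    have hy1 : ‖y‖ ≤ 1 := (pi_norm_le_iff_of_nonneg zero_le_one).2 fun k => by
      have := hy k trivial
      simp only [Set.mem_Ioo] at this
      rw [Real.norm_eq_abs, abs_le]
      constructor <;> linarith
    have h1 : |∑ j, B i j * y j| ≤ M * Metric.infDist y (unitCube N)ᶜ := by
      calc _ ≤ N * ‖B‖ * ‖y‖ := abs_matrix_apply_le B y i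
        _ ≤ N * ‖B‖ * 1 := by gcongr
        _ ≤ M * r := by rwa [mul_one]
        _ ≤ _ := by gcongr; exact le_infDist_of_mem_shrunkCube hy
    rw [abs_le] at h1
    simp only [truncatedLinear, min_eq_right h1.2, max_eq_right h1.1]
    simp [Matrix.mulVec, dotProduct]
  ext i j
  rw [gradMatrix, heq.fderiv_eq, ContinuousLinearMap.fderiv]
  simp

lemma measureReal_unitCube_diff_shrunkCube_le (N : ℕ) {r : ℝ} (hr : 0 < r) (hr2 : r ≤ 1 / 2) :
    volume.real (unitCube N \ shrunkCube N r) ≤ 2 * N * r := by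
  have hsub : shrunkCube N r ⊆ unitCube N :=
    Set.pi_mono fun _ _ => Set.Ioo_subset_Ioo hr.le (by linarith)
  have hmeas : MeasurableSet (shrunkCube N r) :=
    MeasurableSet.univ_pi fun _ => measurableSet_Ioo
  have hvol : volume.real (shrunkCube N r) = (1 - r - r) ^ N := by
    have h0 : 0 ≤ 1 - r - r := by linarith
    simp [shrunkCube, measureReal_def, volume_pi_pi, h0]
  rw [measureReal_sdiff hsub hmeas (by simp [volume_unitCube]), hvol, measureReal_def,
    volume_unitCube]
  have := one_add_mul_le_pow (a := -(2 * r)) (by linarith) N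
  rw [show 1 - r - r = 1 + -(2 * r) by ring, ENNReal.toReal_one]
  linarith

lemma IsQuasiconvexFn.le_add_of_shrink {d N : ℕ} [NeZero N] {h : (Fin d → Fin N → ℝ) → ℝ}
    {c : ℝ} (hc : 0 ≤ c) (hnn : ∀ z, 0 ≤ h z) (hqc : IsQuasiconvexFn h)
    (hup : ∀ z, h z ≤ c * (1 + ‖z‖)) (z B : Fin d → Fin N → ℝ) {r : ℝ} (hr : 0 < r)
    (hr2 : r ≤ 1 / 2) :
    h z ≤ h (z + B) + 2 * N * c * (r * (1 + ‖z‖) + N * ‖B‖) := by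
  have hM0 : 0 ≤ N * ‖B‖ / r := by positivity
  set M : NNReal := (N * ‖B‖ / r).toNNReal
  have hMr : (M : ℝ) * r = N * ‖B‖ := by
    rw [Real.coe_toNNReal _ hM0, div_mul_cancel₀ _ hr.ne']
  have hMB : N * ‖B‖ ≤ M := by
    rw [← hMr]
    exact mul_le_of_le_one_right M.2 (by linarith)
  set φ := truncatedLinear B M
  have hφ : LipschitzWith M φ := lipschitzWith_truncatedLinear B hMB
  have hsub : shrunkCube N r ⊆ unitCube N :=
    Set.pi_mono fun _ _ => Set.Ioo_subset_Ioo hr.le (by linarith)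
  have hmeas : MeasurableSet (shrunkCube N r) :=
    MeasurableSet.univ_pi fun _ => measurableSet_Ioo
  have hq := hqc z φ ⟨M, hφ⟩ fun x hx => truncatedLinear_eq_zero B M hx
  have hBig : 0 ≤ h (z + B) := hnn _
  by_cases h_integrable : IntegrableOn (fun x => h (z + gradMatrix φ x)) (unitCube N)
  swap
  · rw [integral_undef h_integrable] at hq
    have : 0 ≤ 2 * N * c * (r * (1 + ‖z‖) + N * ‖B‖) := by positivity
    linarith
  have hsplit := setIntegral_union (μ := volume) (f := fun x => h (z + gradMatrix φ x))
    (Set.disjoint_sdiff_right (s := shrunkCube N r) (t := unitCube N))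
    ((isOpen_unitCube N).measurableSet.diff hmeas) (h_integrable.mono_set hsub)
    (h_integrable.mono_set Set.sdiff_subset)
  rw [Set.union_sdiff_cancel hsub] at hsplit
  rw [hsplit] at hq
  have hgood : ∫ x in shrunkCube N r, h (z + gradMatrix φ x) ≤ h (z + B) := by
    rw [setIntegral_congr_fun hmeas (g := fun _ => h (z + B)) fun x hx => by
      simp only [φ, gradMatrix_truncatedLinear B hr hMr.ge hx], setIntegral_const, smul_eq_mul]
    refine mul_le_of_le_one_left hBig ?_
    calc volume.real (shrunkCube N r) ≤ volume.real (unitCube N) :=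
          measureReal_mono hsub (by simp [volume_unitCube])
      _ = 1 := by simp [measureReal_def, volume_unitCube]
  have hbad : ∫ x in unitCube N \ shrunkCube N r, h (z + gradMatrix φ x) ≤
      c * (1 + (‖z‖ + M)) * (2 * N * r) := by
    have hfin : volume (unitCube N \ shrunkCube N r) < ⊤ :=
      (measure_mono Set.sdiff_subset).trans_lt (by simp [volume_unitCube])
    calc ∫ x in unitCube N \ shrunkCube N r, h (z + gradMatrix φ x)
        ≤ ‖∫ x in unitCube N \ shrunkCube N r, h (z + gradMatrix φ x)‖ := le_abs_self _
      _ ≤ c * (1 + (‖z‖ + M)) * volume.real (unitCube N \ shrunkCube N r) := by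
          refine norm_setIntegral_le_of_norm_le_const hfin fun x _ => ?_
          rw [Real.norm_eq_abs, abs_of_nonneg (hnn _)]
          refine (hup _).trans ?_
          gcongr
          exact (norm_add_le _ _).trans (by gcongr; exact norm_gradMatrix_le hφ x)
      _ ≤ _ := by
          gcongr
          exact measureReal_unitCube_diff_shrunkCube_le N hr hr2
  have hfinal : c * (1 + (‖z‖ + M)) * (2 * N * r) =
      2 * N * c * (r * (1 + ‖z‖) + N * ‖B‖) := by
    rw [← hMr]; ring
  linarith

/-- A nonnegative quasiconvex function of linear growth is globally Lipschitz. -/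
lemma IsQuasiconvexFn.lipschitz {d N : ℕ} {h : (Fin d → Fin N → ℝ) → ℝ} {c : ℝ} (hc : 0 ≤ c)
    (hnn : ∀ z, 0 ≤ h z) (hqc : IsQuasiconvexFn h) (hup : ∀ z, h z ≤ c * (1 + ‖z‖)) :
    ∃ L : NNReal, LipschitzWith L h := by
  rcases Nat.eq_zero_or_pos N with rfl | hN
  · exact ⟨0, LipschitzWith.of_dist_le_mul fun x y => by simp [Subsingleton.elim x y]⟩
  have : NeZero N := ⟨hN.ne'⟩
  refine ⟨(2 * N * c * N).toNNReal, LipschitzWith.of_le_add_mul _ fun z w => ?_⟩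
  have hlim : Tendsto (fun r : ℝ => h w + 2 * N * c * (r * (1 + ‖z‖) + N * dist z w))
      (nhdsWithin 0 (Set.Ioi 0)) (nhds (h w + 2 * N * c * (0 * (1 + ‖z‖) + N * dist z w))) :=
    (Continuous.tendsto (by fun_prop) 0).mono_left nhdsWithin_le_nhds
  refine (ge_of_tendsto hlim ?_).trans_eq (by rw [Real.coe_toNNReal _ (by positivity)]; ring)
  filter_upwards [Ioc_mem_nhdsGT (show (0 : ℝ) < 1 / 2 by norm_num)] with r hr
  have := hqc.le_add_of_shrink hc hnn hup z (w - z) hr.1 hr.2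
  rwa [add_sub_cancel, ← dist_eq_norm, dist_comm w z] at this

section Recession

variable {d N : ℕ} {h : (Fin d → Fin N → ℝ) → ℝ} {c : ℝ}

lemma div_smul_nonneg (hnn : ∀ z, 0 ≤ h z) (z : Fin d → Fin N → ℝ) {t : ℝ} (ht : 1 ≤ t) :
    0 ≤ h (t • z) / t := div_nonneg (hnn _) (by linarith)

lemma div_smul_le (hc : 0 ≤ c) (hup : ∀ z, h z ≤ c * (1 + ‖z‖)) (z : Fin d → Fin N → ℝ)
    {t : ℝ} (ht : 1 ≤ t) : h (t • z) / t ≤ c * (1 + ‖z‖) := by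
  have ht0 : 0 < t := by linarith
  rw [div_le_iff₀ ht0]
  calc h (t • z) ≤ c * (1 + ‖t • z‖) := hup _
    _ = c * (1 + t * ‖z‖) := by rw [norm_smul, Real.norm_of_nonneg ht0.le]
    _ ≤ c * (t + t * ‖z‖) := by gcongr
    _ = c * (1 + ‖z‖) * t := by ring

lemma isBoundedUnder_div_smul (hc : 0 ≤ c) (hup : ∀ z, h z ≤ c * (1 + ‖z‖))
    (z : Fin d → Fin N → ℝ) : IsBoundedUnder (· ≤ ·) atTop fun t : ℝ => h (t • z) / t :=
  isBoundedUnder_of_eventually_le (a := c * (1 + ‖z‖)) <| by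
    filter_upwards [eventually_ge_atTop 1] with t ht using div_smul_le hc hup z ht

lemma isCoboundedUnder_div_smul (hnn : ∀ z, 0 ≤ h z) (z : Fin d → Fin N → ℝ) :
    IsCoboundedUnder (· ≤ ·) atTop fun t : ℝ => h (t • z) / t :=
  (isBoundedUnder_of_eventually_ge (a := 0) <| by
    filter_upwards [eventually_ge_atTop 1] with t ht
      using div_smul_nonneg hnn z ht).isCoboundedUnder_le

lemma eventually_div_smul_lt (hc : 0 ≤ c) (hup : ∀ z, h z ≤ c * (1 + ‖z‖))
    {z : Fin d → Fin N → ℝ} {b : ℝ} (hb : recessionOf h z < b) :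
    ∀ᶠ t : ℝ in atTop, h (t • z) / t < b :=
  eventually_lt_of_limsup_lt hb (isBoundedUnder_div_smul hc hup z)

lemma recessionOf_le (hnn : ∀ z, 0 ≤ h z) {z : Fin d → Fin N → ℝ} {b : ℝ}
    (hb : ∀ᶠ t : ℝ in atTop, h (t • z) / t ≤ b) : recessionOf h z ≤ b :=
  limsup_le_of_le (isCoboundedUnder_div_smul hnn z) hb

lemma recessionOf_nonneg (hc : 0 ≤ c) (hnn : ∀ z, 0 ≤ h z) (hup : ∀ z, h z ≤ c * (1 + ‖z‖))
    (z : Fin d → Fin N → ℝ) : 0 ≤ recessionOf h z := by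
  refine le_limsup_of_frequently_le (Eventually.frequently ?_) (isBoundedUnder_div_smul hc hup z)
  filter_upwards [eventually_ge_atTop 1] with t ht using div_smul_nonneg hnn z ht

lemma lipschitzWith_recessionOf (hc : 0 ≤ c) (hnn : ∀ z, 0 ≤ h z)
    (hup : ∀ z, h z ≤ c * (1 + ‖z‖)) {L : NNReal} (hL : LipschitzWith L h) :
    LipschitzWith L (recessionOf h) := by
  refine LipschitzWith.of_le_add_mul _ fun z w => le_of_forall_pos_le_add fun ε hε => ?_
  refine recessionOf_le hnn ?_
  filter_upwards [eventually_gt_atTop 0,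
    eventually_div_smul_lt hc hup (lt_add_of_pos_right (recessionOf h w) hε)] with t ht hw
  rw [div_lt_iff₀ ht] at hw
  rw [div_le_iff₀ ht]
  have h1 := hL.le_add_mul (t • z) (t • w)
  rw [dist_smul₀, Real.norm_of_nonneg ht.le] at h1
  nlinarith

end Recession

/-- if `h ≥ 0` is quasiconvex and `h(z) ≤ c(1+|z|)`, then the recession
function `h^∞` is quasiconvex. -/
theorem recession_quasiconvex {d N : ℕ} (h : (Fin d → Fin N → ℝ) → ℝ) (c : ℝ) (hc : 0 < c)
    (hnn : ∀ z, 0 ≤ h z)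
    (hqc : IsQuasiconvexFn h)
    (hup : ∀ z, h z ≤ c * (1 + ‖z‖)) :
    IsQuasiconvexFn (recessionOf h) := by
  intro z φ ⟨K, hK⟩ hφ
  obtain ⟨L, hL⟩ := hqc.lipschitz hc.le hnn hup
  have hLrec := lipschitzWith_recessionOf hc.le hnn hup hL
  have hgrad : Measurable fun x => z + gradMatrix φ x := (measurable_gradMatrix φ).const_add z
  have : IsFiniteMeasure (volume.restrict (unitCube N)) := ⟨by simp [volume_unitCube]⟩
  set C := c * (1 + (‖z‖ + K))
  have hC : ∀ x, c * (1 + ‖z + gradMatrix φ x‖) ≤ C := fun x => by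
    dsimp only [C]
    gcongr
    exact (norm_add_le _ _).trans (by gcongr; exact norm_gradMatrix_le hK x)
  have hrecC : ∀ x, recessionOf h (z + gradMatrix φ x) ≤ C := fun x => recessionOf_le hnn <| by
    filter_upwards [eventually_ge_atTop 1] with t ht
      using (div_smul_le hc.le hup _ ht).trans (hC x)
  have hmeas : ∀ t : ℝ, Measurable fun x => h (t • (z + gradMatrix φ x)) / t := fun t =>
    (hL.continuous.measurable.comp (hgrad.const_smul t)).div_const t
  have hmeas_rec : Measurable fun x => recessionOf h (z + gradMatrix φ x) :=
    hLrec.continuous.measurable.comp hgrad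
  have hbound : ∀ t : ℝ, 1 ≤ t → ∀ x,
      ‖max (h (t • (z + gradMatrix φ x)) / t) (recessionOf h (z + gradMatrix φ x))‖ ≤ C := by
    intro t ht x
    rw [Real.norm_of_nonneg (le_max_of_le_left (div_smul_nonneg hnn _ ht))]
    exact max_le ((div_smul_le hc.le hup _ ht).trans (hC x)) (hrecC x)
  have hlim : Tendsto (fun t : ℝ => ∫ x in unitCube N,
      max (h (t • (z + gradMatrix φ x)) / t) (recessionOf h (z + gradMatrix φ x))) atTop
      (nhds (∫ x in unitCube N, recessionOf h (z + gradMatrix φ x))) := by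
    refine tendsto_integral_filter_of_dominated_convergence (fun _ => C)
      (Eventually.of_forall fun t => ((hmeas t).max hmeas_rec).aestronglyMeasurable) ?_
      (integrable_const C) (ae_of_all _ fun x => ?_)
    · filter_upwards [eventually_ge_atTop 1] with t ht using ae_of_all _ (hbound t ht)
    · refine tendsto_order.2 ⟨fun a ha => Eventually.of_forall fun t => lt_max_of_lt_right ha,
        fun b hb => ?_⟩
      filter_upwards [eventually_div_smul_lt hc.le hup hb] with t ht using max_lt ht hb
  refine le_of_forall_pos_le_add fun ε hε => recessionOf_le hnn ?_
  filter_upwards [eventually_ge_atTop 1, hlim.eventually_lt_const (lt_add_of_pos_right _ hε)]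
    with t ht hlt
  refine le_trans ?_ hlt.le
  have ht0 : 0 < t := by linarith
  have hq := hqc (t • z) (t • φ) ⟨_, (lipschitzWith_smul t).comp hK⟩
    fun x hx => by simp [hφ x hx]
  simp_rw [gradMatrix_const_smul, ← smul_add] at hq
  have h_integrable_max : IntegrableOn (fun x => max (h (t • (z + gradMatrix φ x)) / t)
      (recessionOf h (z + gradMatrix φ x))) (unitCube N) :=
    Integrable.of_bound ((hmeas t).max hmeas_rec).aestronglyMeasurable C
      (ae_of_all _ (hbound t ht))
  calc h (t • z) / t ≤ (∫ x in unitCube N, h (t • (z + gradMatrix φ x))) / t := by gcongr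
    _ = ∫ x in unitCube N, h (t • (z + gradMatrix φ x)) / t := (integral_div _ _).symm
    _ ≤ _ := integral_mono_of_nonneg (ae_of_all _ fun x => div_smul_nonneg hnn _ ht) h_integrable_max
        (ae_of_all _ fun x => le_max_left _ _)

end
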